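/- arXiv:1207.4470 — 2 statements merged into one kernel-verified Lean document; each statement's English description precedes it below -/
import Mathlib

section
/- The GL(7, ℝ)-orbit of φ₀ is open in Λ³(ℝ⁷)*: the set of alternating trilinear forms φ on ℝ⁷ for which there exists an ℝ-linear automorphism g of ℝ⁷ with φ(u, v, w) = φ₀(gu, gv, gw) for all u, v, w ∈ ℝ⁷ is an open subset of the space of alternating trilinear forms on ℝ⁷ (with its standard finite-dimensional topology). -/
open scoped RealInnerProductSpace

noncomputable section

abbrev E7 : Type := EuclideanSpace ℝ (Fin 7)

/-- `dxⁱ ∧ dxʲ ∧ dxᵏ` evaluated on the triple `(u, v, w)`. -/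
def triDet (u v w : E7) (i j k : Fin 7) : ℝ :=
  Matrix.det !![u i, u j, u k; v i, v j, v k; w i, w j, w k]

/-- The standard G₂ 3-form `φ₀ = dx¹²³ + dx¹⁴⁵ + dx¹⁶⁷ + dx²⁴⁶ − dx²⁵⁷ − dx³⁴⁷ − dx³⁵⁶`
(here with 0-indexed coordinates). -/
def phi0 (u v w : E7) : ℝ :=
  triDet u v w 0 1 2 + triDet u v w 0 3 4 + triDet u v w 0 5 6 +
    triDet u v w 1 3 5 - triDet u v w 1 4 6 - triDet u v w 2 3 6 - triDet u v w 2 4 5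

/-- `f : ℝ⁷ × ℝ⁷ × ℝ⁷ → ℝ` is an alternating trilinear form. -/
def IsAltTrilinear (f : E7 → E7 → E7 → ℝ) : Prop :=
  (∀ a a' b c : E7, f (a + a') b c = f a b c + f a' b c) ∧
  (∀ (r : ℝ) (a b c : E7), f (r • a) b c = r * f a b c) ∧
  (∀ a b b' c : E7, f a (b + b') c = f a b c + f a b' c) ∧
  (∀ (r : ℝ) (a b c : E7), f a (r • b) c = r * f a b c) ∧
  (∀ a b c c' : E7, f a b (c + c') = f a b c + f a b c') ∧
  (∀ (r : ℝ) (a b c : E7), f a b (r • c) = r * f a b c) ∧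
  (∀ a b : E7, f a a b = 0) ∧ (∀ a b : E7, f a b b = 0) ∧ (∀ a b : E7, f a b a = 0)

/-- The components of `φ₀` in the standard basis. With 1-indexed coordinates, the triples occurring
in `φ₀` are those with vanishing bitwise sum; the signs are stored as bits of a numeral. -/
def phiCoeff (i j k : Fin 7) : ℤ :=
  if (i.val + 1) ^^^ (j.val + 1) = k.val + 1 then
    if Nat.testBit 112770651022890 (7 * i.val + j.val) then 1 else -1
  else 0

/-- `dxᵃ ∧ dxᵇ ∧ dxᶜ` evaluated on the basis vectors `e_i, e_j, e_k`. -/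
def triDelta (i j k a b c : Fin 7) : ℤ :=
  let d (x y : Fin 7) : ℤ := if x = y then 1 else 0
  d a i * d b j * d c k - d a i * d c j * d b k - d b i * d a j * d c k + d b i * d c j * d a k +
    d c i * d a j * d b k - d c i * d b j * d a k

/-- Six times an element of `gl(7)` whose infinitesimal action sends `φ₀` to
`dxⁱ ∧ dxʲ ∧ dxᵏ`. -/
def liftCoeff (i j k a b : Fin 7) : ℤ :=
  let eta (a b : Fin 7) : ℤ := (if a = i then phiCoeff b j k else 0) +
    (if a = j then phiCoeff b k i else 0) + (if a = k then phiCoeff b i j else 0)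
  eta a b + 2 * eta b a - if a = b then phiCoeff i j k else 0

/-- The infinitesimal action of the integer matrix `A` on `φ₀`, in components. -/
def actionCoeff (A : Fin 7 → Fin 7 → ℤ) (p q r : Fin 7) : ℤ :=
  ∑ a, (A a p * phiCoeff a q r + A a q * phiCoeff p a r + A a r * phiCoeff p q a)

/-- Increasing triples, which index the coordinates of `Λ³(ℝ⁷)*`. -/
abbrev IncTriple : Type := {t : Fin 7 × Fin 7 × Fin 7 // t.1 < t.2.1 ∧ t.2.1 < t.2.2}

/-- The standard basis vector `e_i` of `ℝ⁷`. -/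
abbrev stdVec (i : Fin 7) : E7 := EuclideanSpace.single i 1

theorem phiCoeff_eq_triDelta : ∀ i j k : Fin 7, phiCoeff i j k =
    triDelta i j k 0 1 2 + triDelta i j k 0 3 4 + triDelta i j k 0 5 6 +
      triDelta i j k 1 3 5 - triDelta i j k 1 4 6 - triDelta i j k 2 3 6 -
      triDelta i j k 2 4 5 := by
  decide +kernel

theorem actionCoeff_liftCoeff : ∀ i j : Fin 7, i < j → ∀ k, j < k → ∀ p q, p < q → ∀ r, q < r →
    actionCoeff (liftCoeff i j k) p q r = if (i, j, k) = (p, q, r) then 6 else 0 := by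
  decide +kernel

theorem triDet_stdVec (i j k a b c : Fin 7) :
    triDet (stdVec i) (stdVec j) (stdVec k) a b c = triDelta i j k a b c := by
  simp [triDet, triDelta, Matrix.det_fin_three]

theorem phi0_stdVec (i j k : Fin 7) :
    phi0 (stdVec i) (stdVec j) (stdVec k) = phiCoeff i j k := by
  simp only [phi0, triDet_stdVec, phiCoeff_eq_triDelta]
  push_cast
  ring

theorem isAltTrilinear_phi0 : IsAltTrilinear phi0 := by
  refine ⟨?_, ?_, ?_, ?_, ?_, ?_, ?_, ?_, ?_⟩ <;> intros <;>
    simp only [phi0, triDet, Matrix.det_fin_three, Matrix.of_apply, Matrix.cons_val, PiLp.add_apply,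
      PiLp.smul_apply, smul_eq_mul] <;> ring

namespace IsAltTrilinear

variable {f h : E7 → E7 → E7 → ℝ}

theorem comp_linearMap (hf : IsAltTrilinear f) (g : E7 →ₗ[ℝ] E7) :
    IsAltTrilinear fun u v w => f (g u) (g v) (g w) := by
  obtain ⟨h1, h2, h3, h4, h5, h6, h7, h8, h9⟩ := hf
  refine ⟨?_, ?_, ?_, ?_, ?_, ?_, ?_, ?_, ?_⟩ <;> intros <;> simp [*]

theorem sub (hf : IsAltTrilinear f) (hh : IsAltTrilinear h) :
    IsAltTrilinear fun u v w => f u v w - h u v w := by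
  obtain ⟨h1, h2, h3, h4, h5, h6, h7, h8, h9⟩ := hf
  obtain ⟨k1, k2, k3, k4, k5, k6, k7, k8, k9⟩ := hh
  refine ⟨?_, ?_, ?_, ?_, ?_, ?_, ?_, ?_, ?_⟩ <;> intros <;> simp only [*] <;> ring

theorem swap_left (hf : IsAltTrilinear f) (a b c : E7) : f b a c = -f a b c := by
  obtain ⟨h1, -, h3, -, -, -, h7, -, -⟩ := hf
  have h := h7 (a + b) c
  simp only [h1, h3, h7] at h
  linarith

theorem swap_right (hf : IsAltTrilinear f) (a b c : E7) : f a c b = -f a b c := by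
  obtain ⟨-, -, h3, -, h5, -, -, h8, -⟩ := hf
  have h := h8 a (b + c)
  simp only [h3, h5, h8] at h
  linarith

theorem map_sum_smul_fst (hf : IsAltTrilinear f) {ι : Type*} (s : Finset ι) (m : ι → ℝ)
    (x : ι → E7) (b c : E7) : f (∑ i ∈ s, m i • x i) b c = ∑ i ∈ s, m i * f (x i) b c := by
  obtain ⟨h1, h2, -⟩ := hf
  let F : E7 →ₗ[ℝ] ℝ := IsLinearMap.mk' (fun a => f a b c)
    ⟨fun a a' => h1 a a' b c, fun r a => h2 r a b c⟩
  exact (map_sum F (fun i => m i • x i) s).trans (Finset.sum_congr rfl fun i _ => h2 _ _ _ _)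

theorem map_sum_smul_snd (hf : IsAltTrilinear f) {ι : Type*} (s : Finset ι) (m : ι → ℝ)
    (x : ι → E7) (a c : E7) : f a (∑ i ∈ s, m i • x i) c = ∑ i ∈ s, m i * f a (x i) c := by
  rw [← neg_inj, ← hf.swap_left, hf.map_sum_smul_fst, ← Finset.sum_neg_distrib]
  simp only [hf.swap_left a, mul_neg]

theorem map_sum_smul_trd (hf : IsAltTrilinear f) {ι : Type*} (s : Finset ι) (m : ι → ℝ)
    (x : ι → E7) (a b : E7) : f a b (∑ i ∈ s, m i • x i) = ∑ i ∈ s, m i * f a b (x i) := by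
  rw [← neg_inj, ← hf.swap_right, hf.map_sum_smul_snd, ← Finset.sum_neg_distrib]
  simp only [hf.swap_right a b, mul_neg]

/-- An alternating trilinear form which vanishes on increasing triples of basis vectors is zero. -/
theorem eq_zero_of_increasing (hf : IsAltTrilinear f)
    (h0 : ∀ i j k, i < j → j < k → f (stdVec i) (stdVec j) (stdVec k) = 0) (u v w : E7) :
    f u v w = 0 := by
  have hS (i j k) (h : f (stdVec i) (stdVec j) (stdVec k) = 0) :
      f (stdVec j) (stdVec i) (stdVec k) = 0 := by rw [hf.swap_left, h, neg_zero]
  have hR (i j k) (h : f (stdVec i) (stdVec j) (stdVec k) = 0) :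
      f (stdVec i) (stdVec k) (stdVec j) = 0 := by rw [hf.swap_right, h, neg_zero]
  have hbasis (i j k) : f (stdVec i) (stdVec j) (stdVec k) = 0 := by
    obtain ⟨-, -, -, -, -, -, h7, h8, h9⟩ := hf
    rcases lt_trichotomy i j with hij | rfl | hij
    · rcases lt_trichotomy j k with hjk | rfl | hjk
      · exact h0 _ _ _ hij hjk
      · exact h8 _ _
      · rcases lt_trichotomy i k with hik | rfl | hik
        · exact hR _ _ _ (h0 _ _ _ hik hjk)
        · exact h9 _ _
        · exact hR _ _ _ (hS _ _ _ (h0 _ _ _ hik hij))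
    · exact h7 _ _
    · rcases lt_trichotomy i k with hik | rfl | hik
      · exact hS _ _ _ (h0 _ _ _ hij hik)
      · exact h9 _ _
      · rcases lt_trichotomy j k with hjk | rfl | hjk
        · exact hS _ _ _ (hR _ _ _ (h0 _ _ _ hjk hik))
        · exact h8 _ _
        · exact hS _ _ _ (hR _ _ _ (hS _ _ _ (h0 _ _ _ hjk hij)))
  have hsum (x : E7) : x = ∑ i, x i • stdVec i := by
    simpa using ((EuclideanSpace.basisFun (Fin 7) ℝ).sum_repr x).symm
  rw [hsum u, hsum v, hsum w]
  simp [hf.map_sum_smul_fst, hf.map_sum_smul_snd, hf.map_sum_smul_trd, hbasis]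

theorem ext_increasing (hf : IsAltTrilinear f) (hh : IsAltTrilinear h)
    (hfh : ∀ i j k, i < j → j < k →
      f (stdVec i) (stdVec j) (stdVec k) = h (stdVec i) (stdVec j) (stdVec k)) (u v w : E7) :
    f u v w = h u v w :=
  sub_eq_zero.1 <| (hf.sub hh).eq_zero_of_increasing
    (fun i j k hij hjk => sub_eq_zero.2 (hfh i j k hij hjk)) u v w

end IsAltTrilinear

/-- The coordinates of the form `g^* φ₀`. -/
def pullbackCoord (g : E7 →L[ℝ] E7) (t : IncTriple) : ℝ :=
  phi0 (g (stdVec t.1.1)) (g (stdVec t.1.2.1)) (g (stdVec t.1.2.2))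

theorem contDiff_pullbackCoord : ContDiff ℝ 1 pullbackCoord := by
  refine contDiff_pi.2 fun t => ?_
  have hcoord (v : E7) (a : Fin 7) : ContDiff ℝ 1 fun g : E7 →L[ℝ] E7 => g v a :=
    ((EuclideanSpace.proj (𝕜 := ℝ) a).comp (ContinuousLinearMap.apply ℝ E7 v)).contDiff
  simp only [pullbackCoord, phi0, triDet, Matrix.det_fin_three, Matrix.of_apply, Matrix.cons_val]
  fun_prop

/-- The differential at the identity of `g ↦ g^* φ₀` is the infinitesimal action on `φ₀`. -/
theorem fderiv_pullbackCoord_one (A : E7 →L[ℝ] E7) (t : IncTriple) :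
    fderiv ℝ pullbackCoord (ContinuousLinearMap.id ℝ E7) A t =
      phi0 (A (stdVec t.1.1)) (stdVec t.1.2.1) (stdVec t.1.2.2) +
        phi0 (stdVec t.1.1) (A (stdVec t.1.2.1)) (stdVec t.1.2.2) +
        phi0 (stdVec t.1.1) (stdVec t.1.2.1) (A (stdVec t.1.2.2)) := by
  have hline : HasDerivAt (fun s : ℝ => ContinuousLinearMap.id ℝ E7 + s • A) A 0 := by
    simpa using ((hasDerivAt_id (0 : ℝ)).smul_const A).const_add (ContinuousLinearMap.id ℝ E7)
  have hF : HasFDerivAt pullbackCoord (fderiv ℝ pullbackCoord (ContinuousLinearMap.id ℝ E7))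
      (ContinuousLinearMap.id ℝ E7 + (0 : ℝ) • A) := by
    have h0 : ContinuousLinearMap.id ℝ E7 + (0 : ℝ) • A = ContinuousLinearMap.id ℝ E7 := by
      ext; simp
    rw [h0]
    exact (contDiff_pullbackCoord.differentiable one_ne_zero _).hasFDerivAt
  have hchain := hasDerivAt_pi.1 (hF.comp_hasDerivAt (0 : ℝ) hline) t
  refine hchain.unique ?_
  generalize hx : stdVec t.1.1 = x
  generalize hy : stdVec t.1.2.1 = y
  generalize hz : stdVec t.1.2.2 = z
  obtain ⟨h1, h2, h3, h4, h5, h6, -, -, -⟩ := isAltTrilinear_phi0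
  have hexp : (fun s : ℝ => pullbackCoord (ContinuousLinearMap.id ℝ E7 + s • A) t) = fun s =>
      phi0 x y z + s * (phi0 (A x) y z + phi0 x (A y) z + phi0 x y (A z)) +
        s ^ 2 * (phi0 (A x) (A y) z + phi0 (A x) y (A z) + phi0 x (A y) (A z)) +
        s ^ 3 * phi0 (A x) (A y) (A z) := by
    funext s
    simp only [pullbackCoord, hx, hy, hz, add_apply,
      smul_apply, ContinuousLinearMap.id_apply, h1, h2, h3, h4, h5, h6]
    ring
  change HasDerivAt (fun s : ℝ => pullbackCoord (ContinuousLinearMap.id ℝ E7 + s • A) t) _ 0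
  rw [hexp]
  have hid := hasDerivAt_id (0 : ℝ)
  refine ((((hid.mul_const _).const_add _).add ((hid.pow 2).mul_const _)).add
    ((hid.pow 3).mul_const _)).congr_deriv ?_
  simp

theorem exists_clm_stdVec (M : Fin 7 → Fin 7 → ℝ) :
    ∃ A : E7 →L[ℝ] E7, ∀ p, A (stdVec p) = ∑ a, M a p • stdVec a := by
  refine ⟨LinearMap.toContinuousLinearMap ((EuclideanSpace.basisFun (Fin 7) ℝ).toBasis.constr ℝ
    fun p => ∑ a, M a p • stdVec a), fun p => ?_⟩
  simp [Module.Basis.constr_apply_fintype]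

theorem exists_fderiv_pullbackCoord_eq_single (t : IncTriple) : ∃ A : E7 →L[ℝ] E7,
    fderiv ℝ pullbackCoord (ContinuousLinearMap.id ℝ E7) A = Pi.single t 6 := by
  obtain ⟨⟨i, j, k⟩, hij, hjk⟩ := t
  obtain ⟨A, hA⟩ := exists_clm_stdVec fun a p => (liftCoeff i j k a p : ℝ)
  refine ⟨A, ?_⟩
  ext ⟨⟨p, q, r⟩, hpq, hqr⟩
  have hf := isAltTrilinear_phi0
  have key := congrArg (Int.cast (R := ℝ)) (actionCoeff_liftCoeff i j hij k hjk p q hpq r hqr)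
  rw [fderiv_pullbackCoord_one]
  simp only [hA, hf.map_sum_smul_fst, hf.map_sum_smul_snd, hf.map_sum_smul_trd, phi0_stdVec]
  rw [← Finset.sum_add_distrib, ← Finset.sum_add_distrib]
  simp only [actionCoeff] at key
  push_cast at key
  rw [key, Pi.single_apply]
  simp [Subtype.ext_iff, eq_comm]

theorem range_fderiv_pullbackCoord :
    (fderiv ℝ pullbackCoord (ContinuousLinearMap.id ℝ E7)).range = ⊤ := by
  refine LinearMap.range_eq_top.2 fun c => ?_
  choose A hA using exists_fderiv_pullbackCoord_eq_single
  refine ⟨∑ t, (c t / 6) • A t, ?_⟩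
  ext s
  simp [hA, Finset.sum_apply, Pi.single_apply]

theorem map_nhds_pullbackCoord :
    Filter.map pullbackCoord (nhds (ContinuousLinearMap.id ℝ E7)) =
      nhds (pullbackCoord (ContinuousLinearMap.id ℝ E7)) :=
  (contDiff_pullbackCoord.contDiffAt.hasStrictFDerivAt one_ne_zero).map_nhds_eq_of_surj
    range_fderiv_pullbackCoord

/-- The `GL(7, ℝ)`-orbit of `φ₀` is open in the space of alternating trilinear forms
on `ℝ⁷` (with its standard finite-dimensional topology, here the topology of pointwise
convergence, which agrees with the standard one on this finite-dimensional space). -/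
theorem statement14 :
    IsOpen {φ : {f : E7 → E7 → E7 → ℝ // IsAltTrilinear f} |
      ∃ g : E7 ≃ₗ[ℝ] E7, ∀ u v w : E7, φ.1 u v w = phi0 (g u) (g v) (g w)} := by
  refine isOpen_iff_mem_nhds.2 fun φ ⟨h, hφ⟩ => ?_
  let coord (ψ : {f : E7 → E7 → E7 → ℝ // IsAltTrilinear f}) (t : IncTriple) : ℝ :=
    ψ.1 (h.symm (stdVec t.1.1)) (h.symm (stdVec t.1.2.1)) (h.symm (stdVec t.1.2.2))
  have hcont : Continuous coord := by
    refine continuous_pi fun t => ?_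
    exact (continuous_apply_apply _ _).comp ((continuous_apply _).comp continuous_subtype_val)
  have hcoord : coord φ = pullbackCoord (ContinuousLinearMap.id ℝ E7) := by
    ext t
    simp [coord, pullbackCoord, hφ]
  have himage := Filter.image_mem_map (m := pullbackCoord)
    (ContinuousLinearEquiv.nhds (ContinuousLinearEquiv.refl ℝ E7))
  rw [ContinuousLinearEquiv.coe_refl, map_nhds_pullbackCoord, ← hcoord] at himage
  filter_upwards [hcont.continuousAt.preimage_mem_nhds himage]
  rintro ψ ⟨-, ⟨g, rfl⟩, hg⟩
  refine ⟨h.trans g.toLinearEquiv, fun u v w => ?_⟩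
  have heq := (ψ.2.comp_linearMap h.symm.toLinearMap).ext_increasing
    (isAltTrilinear_phi0.comp_linearMap g.toLinearEquiv.toLinearMap)
    (fun i j k hij hjk => (congrFun hg ⟨(i, j, k), hij, hjk⟩).symm) (h u) (h v) (h w)
  simpa using heq
end
end

section
/- Let L be a unimodular lattice, W ⊆ L a primitive submodule on which the restricted bilinear form is nondegenerate, and T = W^⊥. Then the restriction map L → Hom(W, ℤ), x ↦ ⟨x, ·⟩|_W, is surjective with kernel T (so L/T ≅ W* := Hom(W, ℤ)), and the discriminant groups W*/W and T*/T are isomorphic as abelian groups. -/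
noncomputable section

variable {L : Type*} [AddCommGroup L] [Module ℤ L]

/-- The restriction map `L → Hom(W, ℤ)`, `x ↦ ⟨x, ·⟩|_W`. -/
def resHomL (B : L →ₗ[ℤ] L →ₗ[ℤ] ℤ) (W : Submodule ℤ L) : L →+ (↥W →+ ℤ) :=
  AddMonoidHom.mk' (fun x => AddMonoidHom.mk' (fun w => B x w) (fun w w' => by simp))
    (fun x x' => by ext w; simp)

/-- The natural map `A → Hom(C, ℤ)`, `a ↦ ⟨a, ·⟩|_C`, for submodules `A, C ⊆ L`. -/
def resHom (B : L →ₗ[ℤ] L →ₗ[ℤ] ℤ) (A C : Submodule ℤ L) : ↥A →+ (↥C →+ ℤ) :=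
  AddMonoidHom.mk' (fun a => AddMonoidHom.mk' (fun c => B a c) (fun c c' => by simp))
    (fun a a' => by ext c; simp)

/-- The discriminant group `W*/W` of a sublattice `W ⊆ L`: the cokernel of the natural
map `W → Hom(W, ℤ)`. -/
def discGroup (B : L →ₗ[ℤ] L →ₗ[ℤ] ℤ) (W : Submodule ℤ L) : Type _ :=
  (↥W →+ ℤ) ⧸ (resHom B W W).range

instance (B : L →ₗ[ℤ] L →ₗ[ℤ] ℤ) (W : Submodule ℤ L) : AddCommGroup (discGroup B W) :=
  QuotientAddGroup.Quotient.addCommGroup _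

section PrincipalIdealDomain

variable {R M : Type*} [CommRing R] [IsDomain R] [IsPrincipalIdealRing R] [AddCommGroup M]
  [Module R M] [Module.Finite R M]

/-- A finitely generated quotient by a primitive submodule over a PID is free. -/
theorem free_quotient_of_primitive (W : Submodule R M)
    (hprim : ∀ (r : R) (x : M), r ≠ 0 → r • x ∈ W → x ∈ W) : Module.Free R (M ⧸ W) := by
  have : Module.IsTorsionFree R (M ⧸ W) := by
    refine .of_smul_eq_zero fun r q h => or_iff_not_imp_left.2 fun hr => ?_
    induction q using Submodule.Quotient.induction_on with | _ x
    rw [← Submodule.Quotient.mk_smul, Submodule.Quotient.mk_eq_zero] at h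
    exact (Submodule.Quotient.mk_eq_zero W).2 (hprim r x hr h)
  exact Module.free_of_finite_type_torsion_free'

/-- Every functional on a primitive submodule extends to the whole module. -/
theorem exists_extend_of_primitive (W : Submodule R M)
    (hprim : ∀ (r : R) (x : M), r ≠ 0 → r • x ∈ W → x ∈ W) (f : W →ₗ[R] R) :
    ∃ g : M →ₗ[R] R, ∀ w : W, g w = f w := by
  have := free_quotient_of_primitive W hprim
  obtain ⟨s, hs⟩ := W.mkQ.exists_rightInverse_of_surjective W.range_mkQ
  have hmem : ∀ x : M, (LinearMap.id - s ∘ₗ W.mkQ : M →ₗ[R] M) x ∈ W := fun x => by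
    have h : W.mkQ (s (W.mkQ x)) = W.mkQ x := LinearMap.congr_fun hs (W.mkQ x)
    rw [← Submodule.Quotient.mk_eq_zero, ← Submodule.mkQ_apply]
    simp only [LinearMap.sub_apply, LinearMap.id_apply, LinearMap.comp_apply, map_sub, h, sub_self]
  refine ⟨f ∘ₗ (LinearMap.id - s ∘ₗ W.mkQ : M →ₗ[R] M).codRestrict W hmem, fun w => ?_⟩
  refine congrArg f (Subtype.ext ?_)
  have h : W.mkQ (w : M) = 0 := (Submodule.Quotient.mk_eq_zero W).2 w.2
  simp only [LinearMap.codRestrict_apply, LinearMap.sub_apply, LinearMap.id_apply,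
    LinearMap.comp_apply, h, map_zero, sub_zero]

/-- A primitive submodule is cut out by the functionals vanishing on it. -/
theorem mem_of_forall_functional_eq_zero (W : Submodule R M)
    (hprim : ∀ (r : R) (x : M), r ≠ 0 → r • x ∈ W → x ∈ W) (x : M)
    (hx : ∀ g : M →ₗ[R] R, (∀ w ∈ W, g w = 0) → g x = 0) : x ∈ W := by
  have := free_quotient_of_primitive W hprim
  rw [← Submodule.Quotient.mk_eq_zero, ← Module.forall_dual_apply_eq_zero_iff R]
  refine fun φ => hx (φ ∘ₗ W.mkQ) fun w hw => ?_
  rw [LinearMap.comp_apply, Submodule.mkQ_apply, (Submodule.Quotient.mk_eq_zero W).2 hw, map_zero]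

end PrincipalIdealDomain

/-- In a unimodular lattice, restriction to a primitive submodule is surjective. -/
theorem resHomL_surjective [Module.Finite ℤ L] (B : L →ₗ[ℤ] L →ₗ[ℤ] ℤ)
    (hB : Function.Surjective fun x : L => B x) (W : Submodule ℤ L)
    (hprim : ∀ (n : ℤ) (x : L), n ≠ 0 → n • x ∈ W → x ∈ W) :
    Function.Surjective (resHomL B W) := by
  intro f
  obtain ⟨g, hg⟩ := exists_extend_of_primitive W
    (fun n x hn hx => hprim n x hn (int_smul_eq_zsmul ‹Module ℤ L› n x ▸ hx))
    (@LinearMap.mk ℤ ℤ _ _ (RingHom.id ℤ) W ℤ _ _ W.module _ f.toAddHom fun n w =>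
      @map_intCast_smul _ _ _ _ _ _ _ f ℤ ℤ _ _ W.module _ n w)
  obtain ⟨x, rfl⟩ := hB g
  exact ⟨x, AddMonoidHom.ext hg⟩

/-- In a unimodular lattice, a primitive submodule contains its double orthogonal complement. -/
theorem mem_of_orthogonal_orthogonal [Module.Finite ℤ L] (B : L →ₗ[ℤ] L →ₗ[ℤ] ℤ)
    (hB : Function.Surjective fun x : L => B x) (W : Submodule ℤ L)
    (hprim : ∀ (n : ℤ) (x : L), n ≠ 0 → n • x ∈ W → x ∈ W) (x : L)
    (hx : ∀ t : L, (∀ w ∈ W, B t w = 0) → B t x = 0) : x ∈ W := by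
  refine mem_of_forall_functional_eq_zero W
    (fun n x hn hx => hprim n x hn (int_smul_eq_zsmul ‹Module ℤ L› n x ▸ hx)) x fun g hg => ?_
  obtain ⟨t, rfl⟩ := hB g
  exact hx t hg

theorem resHomL_ker (B : L →ₗ[ℤ] L →ₗ[ℤ] ℤ) (W T : Submodule ℤ L)
    (hT : ∀ x : L, x ∈ T ↔ ∀ w ∈ W, B x w = 0) : (resHomL B W).ker = T.toAddSubgroup := by
  ext x
  rw [AddMonoidHom.mem_ker, Submodule.mem_toAddSubgroup, hT]
  exact ⟨fun h w hw => DFunLike.congr_fun h (⟨w, hw⟩ : W),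
    fun h => AddMonoidHom.ext fun w => h w w.2⟩

/-- If restriction to `W` is surjective and `T = W^⊥`, then `W*/W ≅ L/(W + T)`. -/
theorem nonempty_discGroup_equiv_quotient_sup (B : L →ₗ[ℤ] L →ₗ[ℤ] ℤ) (W T : Submodule ℤ L)
    (hsurj : Function.Surjective (resHomL B W))
    (hT : ∀ x : L, x ∈ T ↔ ∀ w ∈ W, B x w = 0) :
    Nonempty (L ⧸ (W ⊔ T).toAddSubgroup ≃+ discGroup B W) := by
  let π : L →+ (↥W →+ ℤ) ⧸ (resHom B W W).range :=
    (QuotientAddGroup.mk' (resHom B W W).range).comp (resHomL B W)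
  have hπ : Function.Surjective π := (QuotientAddGroup.mk'_surjective _).comp hsurj
  have hker : (W ⊔ T).toAddSubgroup = π.ker := by
    ext x
    rw [Submodule.mem_toAddSubgroup, Submodule.mem_sup, AddMonoidHom.mem_ker]
    refine Iff.trans ?_ (QuotientAddGroup.eq_zero_iff (N := (resHom B W W).range) _).symm
    constructor
    · rintro ⟨w, hw, t, ht, rfl⟩
      refine ⟨⟨w, hw⟩, AddMonoidHom.ext fun v => ?_⟩
      change B w v = B (w + t) v
      rw [map_add, LinearMap.add_apply, (hT t).1 ht v v.2, add_zero]
    · rintro ⟨w, hw⟩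
      refine ⟨w, w.2, x - w, (hT _).2 fun v hv => ?_, add_sub_cancel _ _⟩
      have h : B w v = B x v := DFunLike.congr_fun hw (⟨v, hv⟩ : W)
      rw [map_sub, LinearMap.sub_apply, h, sub_self]
  exact ⟨(QuotientAddGroup.quotientAddEquivOfEq hker).trans
    (QuotientAddGroup.quotientKerEquivOfSurjective π hπ)⟩

/-- Let `L` be a unimodular lattice, `W ⊆ L` a primitive submodule on which the
restricted bilinear form is nondegenerate, and `T = W^⊥`.  Then the restriction map
`L → Hom(W, ℤ)`, `x ↦ ⟨x, ·⟩|_W`, is surjective with kernel `T` (so `L/T ≅ W*`), and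
the discriminant groups `W*/W` and `T*/T` are isomorphic as abelian groups. -/
theorem statement16 [Module.Free ℤ L] [Module.Finite ℤ L]
    (B : L →ₗ[ℤ] L →ₗ[ℤ] ℤ)
    (hsymm : ∀ x y : L, B x y = B y x)
    (hunimod : Function.Bijective fun x : L => B x)
    (W : Submodule ℤ L)
    (hprim : ∀ (n : ℤ) (x : L), n ≠ 0 → n • x ∈ W → x ∈ W)
    (hnondeg : ∀ w ∈ W, (∀ w' ∈ W, B w w' = 0) → w = 0)
    (T : Submodule ℤ L)
    (hT : ∀ x : L, x ∈ T ↔ ∀ w ∈ W, B x w = 0) :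
    Function.Surjective (resHomL B W) ∧
    (resHomL B W).ker = T.toAddSubgroup ∧
    Nonempty ((L ⧸ T) ≃+ (↥W →+ ℤ)) ∧
    Nonempty (discGroup B W ≃+ discGroup B T) := by
  have hTprim : ∀ (n : ℤ) (x : L), n ≠ 0 → n • x ∈ T → x ∈ T := fun n x hn hx =>
    (hT x).2 fun w hw => by
      have h := (hT _).1 hx w hw
      rw [hsymm, map_zsmul, smul_eq_mul, hsymm] at h
      exact (mul_eq_zero.1 h).resolve_left hn
  have hW : ∀ x : L, x ∈ W ↔ ∀ t ∈ T, B x t = 0 := fun x =>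
    ⟨fun hx t ht => (hsymm x t).trans ((hT t).1 ht x hx), fun hx =>
      mem_of_orthogonal_orthogonal B hunimod.2 W hprim x fun t ht =>
        (hsymm t x).trans (hx t ((hT t).2 ht))⟩
  have hsurj := resHomL_surjective B hunimod.2 W hprim
  have hker := resHomL_ker B W T hT
  refine ⟨hsurj, hker, ⟨?_⟩, ?_⟩
  · exact (QuotientAddGroup.quotientAddEquivOfEq hker.symm).trans
      (QuotientAddGroup.quotientKerEquivOfSurjective _ hsurj)
  · obtain ⟨e⟩ := nonempty_discGroup_equiv_quotient_sup B W T hsurj hT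
    obtain ⟨e'⟩ := nonempty_discGroup_equiv_quotient_sup B T W
      (resHomL_surjective B hunimod.2 T hTprim) hW
    rw [sup_comm] at e'
    exact ⟨e.symm.trans e'⟩
end
end
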